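/- arXiv:0912.0688 — 2 statements merged into one kernel-verified Lean document; each statement's English description precedes it below -/
import Mathlib

section
/- Let (P,A,φ,H) be a Poisson quasi-Nijenhuis structure with background on a smooth manifold M and let B be a 2-form on M. Set C = P♯∘B♭ and define P̃ = P, Ã = A + C, φ̃ = φ − dB_C − d(ι_A B), H̃ = H + dB, where B_C(X,Y) = B(CX,Y). Then (P̃, Ã, φ̃, H̃) is a Poisson quasi-Nijenhuis structure with background on M. -/
open scoped Manifold

noncomputable section

/-! ### Smooth functions, vector fields and tensor calculus on a manifold

We work with the algebraic (Lie–Rinehart) presentation of the Cartan calculus of a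
smooth manifold `M`:  smooth real functions form a commutative ring, vector fields are
the derivations of that ring, differential forms are alternating multilinear maps on
vector fields with values in functions, and all classical operations (`d`, interior
products, Lie derivatives, Nijenhuis torsion, concomitants, ...) are given by their
global Koszul-type formulas. -/

variable {EM : Type*} [NormedAddCommGroup EM] [NormedSpace ℝ EM]
  {HM : Type*} [TopologicalSpace HM] (IM : ModelWithCorners ℝ EM HM)
  (M : Type*) [TopologicalSpace M] [ChartedSpace HM M]

/-- The commutative ring of smooth real valued functions on `M`. -/
abbrev SmoothR := C^(⊤ : ℕ∞)⟮IM, M; ℝ⟯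

/-- Vector fields on `M`, presented as derivations of the ring of smooth functions. -/
abbrev VF := Derivation ℝ (SmoothR IM M) (SmoothR IM M)

/-- Covariant 1-tensors (raw). -/
abbrev Cov1 := VF IM M → SmoothR IM M

/-- Covariant 2-tensors (raw). -/
abbrev Cov2 := VF IM M → VF IM M → SmoothR IM M

/-- Covariant 3-tensors (raw). -/
abbrev Cov3 := VF IM M → VF IM M → VF IM M → SmoothR IM M

/-- Covariant 4-tensors (raw). -/
abbrev Cov4 := VF IM M → VF IM M → VF IM M → VF IM M → SmoothR IM M

variable {IM M}

/-- A covariant 1-tensor is a (smooth) 1-form when it is `C^∞(M)`-linear. -/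
def IsOneForm (α : Cov1 IM M) : Prop :=
  (∀ X Y, α (X + Y) = α X + α Y) ∧ ∀ (f : SmoothR IM M) X, α (f • X) = f * α X

/-- A covariant 2-tensor is a (smooth) 2-form when it is `C^∞(M)`-bilinear and
alternating. -/
def IsTwoForm (B : Cov2 IM M) : Prop :=
  (∀ X, IsOneForm (B X)) ∧ (∀ Y, IsOneForm fun X => B X Y) ∧ ∀ X, B X X = 0

/-- A covariant 3-tensor is a (smooth) 3-form when it is `C^∞(M)`-trilinear and
alternating. -/
def IsThreeForm (φ : Cov3 IM M) : Prop :=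
  (∀ X Y, IsOneForm (φ X Y)) ∧ (∀ X Z, IsOneForm fun Y => φ X Y Z) ∧
    (∀ Y Z, IsOneForm fun X => φ X Y Z) ∧
    (∀ X Y, φ X X Y = 0) ∧ (∀ X Y, φ X Y Y = 0) ∧ ∀ X Y, φ X Y X = 0

/-- A `(1,1)`-tensor is a `C^∞(M)`-linear endomorphism of vector fields. -/
def IsTensor11 (A : VF IM M → VF IM M) : Prop :=
  (∀ X Y, A (X + Y) = A X + A Y) ∧ ∀ (f : SmoothR IM M) X, A (f • X) = f • A X

/-- The differential of a function, as a covariant 1-tensor. -/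
def dF (f : SmoothR IM M) : Cov1 IM M := fun X => X f

/-- Exterior differential of a 1-tensor (Koszul formula). -/
def d1 (α : Cov1 IM M) : Cov2 IM M := fun X Y => X (α Y) - Y (α X) - α ⁅X, Y⁆

/-- Exterior differential of a 2-tensor (Koszul formula). -/
def d2 (B : Cov2 IM M) : Cov3 IM M := fun X Y Z =>
  X (B Y Z) - Y (B X Z) + Z (B X Y) - B ⁅X, Y⁆ Z + B ⁅X, Z⁆ Y - B ⁅Y, Z⁆ X

/-- Exterior differential of a 3-tensor (Koszul formula). -/
def d3 (φ : Cov3 IM M) : Cov4 IM M := fun X Y Z W =>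
  X (φ Y Z W) - Y (φ X Z W) + Z (φ X Y W) - W (φ X Y Z)
    - φ ⁅X, Y⁆ Z W + φ ⁅X, Z⁆ Y W - φ ⁅X, W⁆ Y Z
    - φ ⁅Y, Z⁆ X W + φ ⁅Y, W⁆ X Z - φ ⁅Z, W⁆ X Y

/-- Lie derivative of a 1-tensor along a vector field. -/
def lieDer (X : VF IM M) (α : Cov1 IM M) : Cov1 IM M := fun Y => X (α Y) - α ⁅X, Y⁆

/-- The transpose `Aᵗ` of a `(1,1)`-tensor acting on covariant 1-tensors. -/
def transp (A : VF IM M → VF IM M) (α : Cov1 IM M) : Cov1 IM M := fun X => α (A X)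

/-- The degree-zero derivation `ι_A` on 2-tensors. -/
def iota2 (A : VF IM M → VF IM M) (B : Cov2 IM M) : Cov2 IM M := fun X Y =>
  B (A X) Y + B X (A Y)

/-- The degree-zero derivation `ι_A` on 3-tensors. -/
def iota3 (A : VF IM M → VF IM M) (φ : Cov3 IM M) : Cov3 IM M := fun X Y Z =>
  φ (A X) Y Z + φ X (A Y) Z + φ X Y (A Z)

/-- The degree-zero derivation `ι_A` on 4-tensors. -/
def iota4 (A : VF IM M → VF IM M) (ω : Cov4 IM M) : Cov4 IM M := fun X Y Z W =>
  ω (A X) Y Z W + ω X (A Y) Z W + ω X Y (A Z) W + ω X Y Z (A W)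

/-- The derivation `d_A = ι_A ∘ d - d ∘ ι_A` on 2-tensors. -/
def dA2 (A : VF IM M → VF IM M) (B : Cov2 IM M) : Cov3 IM M :=
  iota3 A (d2 B) - d2 (iota2 A B)

/-- The derivation `d_A = ι_A ∘ d - d ∘ ι_A` on 3-tensors. -/
def dA3 (A : VF IM M → VF IM M) (φ : Cov3 IM M) : Cov4 IM M :=
  iota4 A (d3 φ) - d3 (iota3 A φ)

/-- The Nijenhuis torsion of a `(1,1)`-tensor. -/
def torsion (A : VF IM M → VF IM M) (X Y : VF IM M) : VF IM M :=
  ⁅A X, A Y⁆ - A (⁅A X, Y⁆ + ⁅X, A Y⁆ - A ⁅X, Y⁆)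

/-- A bivector field, encoded through its sharp map `P♯ : Ω¹(M) → 𝔛(M)`:
it is `C^∞(M)`-linear and skew-symmetric. -/
def IsBivector (P : Cov1 IM M → VF IM M) : Prop :=
  (∀ α β, P (α + β) = P α + P β) ∧ (∀ (f : SmoothR IM M) α, P (f • α) = f • P α) ∧
    ∀ α β : Cov1 IM M, IsOneForm α → IsOneForm β → α (P β) = - β (P α)

/-- The function `P(α,β)` attached to a bivector `P` (through `P♯`) and two
covariant 1-tensors. -/
def bivFun (P : Cov1 IM M → VF IM M) (α β : Cov1 IM M) : SmoothR IM M := β (P α)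

/-- The Poisson bracket of functions associated with a bivector. -/
def pbracket (P : Cov1 IM M → VF IM M) (f g : SmoothR IM M) : SmoothR IM M :=
  P (dF f) g

/-- A Poisson bivector: a bivector whose bracket of functions satisfies the Jacobi
identity (equivalently, `[P,P] = 0`). -/
def IsPoisson (P : Cov1 IM M → VF IM M) : Prop :=
  IsBivector P ∧ ∀ f g h : SmoothR IM M,
    pbracket P f (pbracket P g h) + pbracket P g (pbracket P h f)
      + pbracket P h (pbracket P f g) = 0

/-- The concomitant `C_{P,A}` of a bivector `P` and a `(1,1)`-tensor `A`,
evaluated on two covariant 1-tensors; formula (1.8) of the paper. -/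
def concom (P : Cov1 IM M → VF IM M) (A : VF IM M → VF IM M) (α β : Cov1 IM M) :
    Cov1 IM M :=
  lieDer (P β) (transp A α) - lieDer (P α) (transp A β)
    + transp A (lieDer (P α) β) - transp A (lieDer (P β) α)
    + dF (bivFun P (transp A α) β) - transp A (dF (bivFun P α β))

/-- The 3-form `ℋ^{S,T}(X,Y,Z) = Σ_{cyclic} H(SX,TY,Z)` built from a 3-tensor and two
`(1,1)`-tensors. -/
def cyc (H : Cov3 IM M) (S T : VF IM M → VF IM M) : Cov3 IM M := fun X Y Z =>
  H (S X) (T Y) Z + H (S Y) (T Z) X + H (S Z) (T X) Y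

/-- The 1-tensor `ι_{X∧Y}ω` (convention `ι_{X∧Y}ω = ι_Y ι_X ω`). -/
def ins2 (X Y : VF IM M) (ω : Cov3 IM M) : Cov1 IM M := fun Z => ω X Y Z

/-- `B_C(X,Y) = B(CX,Y)`. -/
def lcomp (B : Cov2 IM M) (C : VF IM M → VF IM M) : Cov2 IM M := fun X Y => B (C X) Y

/-- A Poisson quasi-Nijenhuis structure with background `(P,A,φ,H)` on `M`
(Definition 1.1 of the paper): `P` is a Poisson bivector, `A` a `(1,1)`-tensor, `φ` and
`H` closed 3-forms, satisfying the four compatibility conditions (2.1)–(2.4). -/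
def IsPqNb (P : Cov1 IM M → VF IM M) (A : VF IM M → VF IM M) (φ H : Cov3 IM M) : Prop :=
  IsPoisson P ∧ IsTensor11 A ∧
    IsThreeForm φ ∧ d3 φ = 0 ∧ IsThreeForm H ∧ d3 H = 0 ∧
    (∀ α : Cov1 IM M, IsOneForm α → A (P α) = P (transp A α)) ∧
    (∀ α β : Cov1 IM M, IsOneForm α → IsOneForm β →
      concom P A α β = fun Z => - H (P α) (P β) Z) ∧
    (∀ X Y, torsion A X Y =
      P (fun Z => φ X Y Z + H (A X) Y Z + H X (A Y) Z)) ∧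
    dA3 A φ = d3 (cyc H A A)


set_option linter.unusedSimpArgs false

section helpers

theorem two_cancel {f : SmoothR IM M} (h : f + f = 0) : f = 0 := by
  have h2 : (2 : ℝ) • f = 0 := by rw [two_smul, h]
  have := congrArg (fun g => (2⁻¹ : ℝ) • g) h2
  simpa [smul_smul] using this

theorem vf_smul_apply (f g : SmoothR IM M) (X : VF IM M) : (f • X) g = f * X g := rfl

theorem lie_smul_left (f : SmoothR IM M) (X Y : VF IM M) :
    ⁅f • X, Y⁆ = f • ⁅X, Y⁆ - Y f • X := by
  ext1 g
  simp only [Derivation.commutator_apply, vf_smul_apply, Derivation.sub_apply, Derivation.leibniz,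
    smul_eq_mul]
  ring

theorem lie_smul_right' (f : SmoothR IM M) (X Y : VF IM M) :
    ⁅X, f • Y⁆ = f • ⁅X, Y⁆ + X f • Y := by
  ext1 g
  simp only [Derivation.commutator_apply, vf_smul_apply, Derivation.add_apply, Derivation.leibniz,
    smul_eq_mul]
  ring

theorem vf_lie_add (X Y Z : VF IM M) : ⁅X, Y + Z⁆ = ⁅X, Y⁆ + ⁅X, Z⁆ := by
  ext1 g
  simp only [Derivation.commutator_apply, Derivation.add_apply, map_add]
  ring

theorem vf_lie_sub (X Y Z : VF IM M) : ⁅X, Y - Z⁆ = ⁅X, Y⁆ - ⁅X, Z⁆ := by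
  ext1 g
  simp only [Derivation.commutator_apply, Derivation.sub_apply, map_sub]
  ring

theorem vf_add_lie (X Y Z : VF IM M) : ⁅X + Y, Z⁆ = ⁅X, Z⁆ + ⁅Y, Z⁆ := by
  ext1 g
  simp only [Derivation.commutator_apply, Derivation.add_apply, map_add]
  ring

theorem vf_skew (X Y : VF IM M) : ⁅X, Y⁆ = -⁅Y, X⁆ := by
  ext1 g
  simp only [Derivation.commutator_apply, Derivation.neg_apply]
  ring

theorem vf_lie_lie (X Y Z : VF IM M) : ⁅⁅X, Y⁆, Z⁆ = ⁅X, ⁅Y, Z⁆⁆ - ⁅Y, ⁅X, Z⁆⁆ := by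
  ext1 g
  simp only [Derivation.commutator_apply, Derivation.sub_apply, map_sub]
  ring

theorem IsOneForm.neg {α : Cov1 IM M} (h : IsOneForm α) (X) : α (-X) = - α X := by
  have h0 : α 0 = 0 := by simpa using h.2 0 0
  have := h.1 X (-X)
  rw [add_neg_cancel, h0] at this
  linear_combination -this

theorem IsOneForm.sub {α : Cov1 IM M} (h : IsOneForm α) (X Y) : α (X - Y) = α X - α Y := by
  rw [sub_eq_add_neg, h.1, h.neg, sub_eq_add_neg]

theorem IsTwoForm.skew {B : Cov2 IM M} (h : IsTwoForm B) (X Y) : B X Y = - B Y X := by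
  have := h.2.2 (X + Y)
  rw [(h.1 _).1, show B (X + Y) X = B X X + B Y X from (h.2.1 X).1 X Y,
    show B (X + Y) Y = B X Y + B Y Y from (h.2.1 Y).1 X Y, h.2.2, h.2.2] at this
  linear_combination this

theorem IsTwoForm.mk' {B : Cov2 IM M} (h1 : ∀ X, IsOneForm (B X)) (h2 : ∀ X Y, B X Y = - B Y X) :
    IsTwoForm B := by
  refine ⟨h1, fun Y => ⟨fun X X' => ?_, fun f X => ?_⟩, fun X => two_cancel ?_⟩
  · beta_reduce; rw [h2, (h1 Y).1, h2 X, h2 X']; ring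
  · beta_reduce; rw [h2, (h1 Y).2, h2 X]; ring
  · linear_combination h2 X X

theorem IsTwoForm.add {B B' : Cov2 IM M} (h : IsTwoForm B) (h' : IsTwoForm B') :
    IsTwoForm (B + B') := by
  refine .mk' (fun X => ⟨fun Y Z => ?_, fun f Y => ?_⟩) fun X Y => ?_
  · simp only [Pi.add_apply, (h.1 X).1, (h'.1 X).1]; ring
  · simp only [Pi.add_apply, (h.1 X).2, (h'.1 X).2]; ring
  · simp only [Pi.add_apply, h.skew X Y, h'.skew X Y]; ring

theorem IsTwoForm.neg {B : Cov2 IM M} (h : IsTwoForm B) : IsTwoForm (-B) := by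
  refine .mk' (fun X => ⟨fun Y Z => ?_, fun f Y => ?_⟩) fun X Y => ?_
  · simp only [Pi.neg_apply, (h.1 X).1]; ring
  · simp only [Pi.neg_apply, (h.1 X).2]; ring
  · simp only [Pi.neg_apply, h.skew X Y]

theorem IsTwoForm.addl {B : Cov2 IM M} (h : IsTwoForm B) (X Y Z) : B (X + Y) Z = B X Z + B Y Z :=
  (h.2.1 Z).1 X Y
theorem IsTwoForm.addr {B : Cov2 IM M} (h : IsTwoForm B) (X Y Z) : B Z (X + Y) = B Z X + B Z Y :=
  (h.1 Z).1 X Y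
theorem IsTwoForm.subl {B : Cov2 IM M} (h : IsTwoForm B) (X Y Z) : B (X - Y) Z = B X Z - B Y Z :=
  (h.2.1 Z).sub X Y
theorem IsTwoForm.subr {B : Cov2 IM M} (h : IsTwoForm B) (X Y Z) : B Z (X - Y) = B Z X - B Z Y :=
  (h.1 Z).sub X Y
theorem IsTwoForm.smull {B : Cov2 IM M} (h : IsTwoForm B) (f X Z) : B (f • X) Z = f * B X Z :=
  (h.2.1 Z).2 f X
theorem IsTwoForm.smulr {B : Cov2 IM M} (h : IsTwoForm B) (f X Z) : B Z (f • X) = f * B Z X :=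
  (h.1 Z).2 f X
theorem IsTwoForm.negl {B : Cov2 IM M} (h : IsTwoForm B) (X Z) : B (-X) Z = - B X Z :=
  (h.2.1 Z).neg X
theorem IsTwoForm.negr {B : Cov2 IM M} (h : IsTwoForm B) (X Z) : B Z (-X) = - B Z X :=
  (h.1 Z).neg X

theorem d2_add (B B' : Cov2 IM M) : d2 (B + B') = d2 B + d2 B' := by
  funext X Y Z
  simp only [d2, Pi.add_apply, map_add]; ring
theorem d2_neg (B : Cov2 IM M) : d2 (-B) = - d2 B := by
  funext X Y Z
  simp only [d2, Pi.neg_apply, map_neg]; ring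
theorem d3_add (B B' : Cov3 IM M) : d3 (B + B') = d3 B + d3 B' := by
  funext X Y Z W
  simp only [d3, Pi.add_apply, map_add]; ring
theorem d3_sub (B B' : Cov3 IM M) : d3 (B - B') = d3 B - d3 B' := by
  funext X Y Z W
  simp only [d3, Pi.sub_apply, map_sub]; ring

theorem IsThreeForm.mk' {φ : Cov3 IM M} (h1 : ∀ X Y, IsOneForm (φ X Y))
    (h2 : ∀ X Y Z, φ X Y Z = - φ Y X Z) (h3 : ∀ X Y Z, φ X Y Z = - φ X Z Y) : IsThreeForm φ := by
  refine ⟨h1, fun X Z => ⟨fun Y Y' => ?_, fun f Y => ?_⟩, fun Y Z => ⟨fun X X' => ?_, fun f X => ?_⟩,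
    fun X Y => two_cancel ?_, fun X Y => two_cancel ?_, fun X Y => two_cancel ?_⟩
  · beta_reduce; rw [h3, (h1 X Z).1, h3 X Y, h3 X Y']; ring
  · beta_reduce; rw [h3, (h1 X Z).2, h3 X Y]; ring
  · beta_reduce; rw [h2, h3, (h1 Y Z).1, h2 X, h3 Y X, h2 X', h3 Y X']; ring
  · beta_reduce; rw [h2, h3, (h1 Y Z).2, h2 X, h3 Y X]; ring
  · linear_combination h2 X X Y
  · linear_combination h3 X Y Y
  · linear_combination h2 X Y X - h3 Y X X + h2 Y X X

theorem IsThreeForm.add1 {φ : Cov3 IM M} (h : IsThreeForm φ) (X X' Y Z) :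
    φ (X + X') Y Z = φ X Y Z + φ X' Y Z := (h.2.2.1 Y Z).1 X X'
theorem IsThreeForm.add2 {φ : Cov3 IM M} (h : IsThreeForm φ) (X Y Y' Z) :
    φ X (Y + Y') Z = φ X Y Z + φ X Y' Z := (h.2.1 X Z).1 Y Y'
theorem IsThreeForm.add3 {φ : Cov3 IM M} (h : IsThreeForm φ) (X Y Z Z') :
    φ X Y (Z + Z') = φ X Y Z + φ X Y Z' := (h.1 X Y).1 Z Z'

theorem IsThreeForm.skew12 {φ : Cov3 IM M} (h : IsThreeForm φ) (X Y Z) : φ X Y Z = - φ Y X Z := by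
  have := h.2.2.2.1 (X + Y) Z
  rw [h.add1, h.add2, h.add2, h.2.2.2.1, h.2.2.2.1] at this
  linear_combination this

theorem IsThreeForm.skew23 {φ : Cov3 IM M} (h : IsThreeForm φ) (X Y Z) : φ X Y Z = - φ X Z Y := by
  have := h.2.2.2.2.1 X (Y + Z)
  rw [h.add2, h.add3, h.add3, h.2.2.2.2.1, h.2.2.2.2.1] at this
  linear_combination this

theorem IsThreeForm.sub {φ ψ : Cov3 IM M} (h : IsThreeForm φ) (h' : IsThreeForm ψ) :
    IsThreeForm (φ - ψ) := by
  refine .mk' (fun X Y => ⟨fun Z Z' => ?_, fun f Z => ?_⟩) (fun X Y Z => ?_) fun X Y Z => ?_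
  · simp only [Pi.sub_apply, (h.1 X Y).1, (h'.1 X Y).1]; ring
  · simp only [Pi.sub_apply, (h.1 X Y).2, (h'.1 X Y).2]; ring
  · simp only [Pi.sub_apply, h.skew12 X, h'.skew12 X]; ring
  · simp only [Pi.sub_apply, h.skew23 X Y Z, h'.skew23 X Y Z]; ring

theorem IsThreeForm.add {φ ψ : Cov3 IM M} (h : IsThreeForm φ) (h' : IsThreeForm ψ) :
    IsThreeForm (φ + ψ) := by
  refine .mk' (fun X Y => ⟨fun Z Z' => ?_, fun f Z => ?_⟩) (fun X Y Z => ?_) fun X Y Z => ?_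
  · simp only [Pi.add_apply, (h.1 X Y).1, (h'.1 X Y).1]; ring
  · simp only [Pi.add_apply, (h.1 X Y).2, (h'.1 X Y).2]; ring
  · simp only [Pi.add_apply, h.skew12 X, h'.skew12 X]; ring
  · simp only [Pi.add_apply, h.skew23 X Y Z, h'.skew23 X Y Z]; ring

theorem IsTwoForm.d2 {B : Cov2 IM M} (h : IsTwoForm B) : IsThreeForm (d2 B) := by
  refine .mk' (fun X Y => ⟨fun Z Z' => ?_, fun f Z => ?_⟩) (fun X Y Z => ?_) fun X Y Z => ?_
  · simp only [_root_.d2, h.addl, h.addr, map_add, vf_lie_add, vf_add_lie, Derivation.add_apply]; ring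
  · simp only [_root_.d2, h.addl, h.addr, h.smull, h.smulr, lie_smul_right', lie_smul_left,
      Derivation.leibniz, smul_eq_mul, vf_smul_apply]
    linear_combination X f * h.skew Z Y - Y f * h.skew Z X
  · simp only [_root_.d2]
    rw [h.skew Y X, vf_skew Y X, h.negl, map_neg]; ring
  · simp only [_root_.d2]
    rw [h.skew Z Y, vf_skew Z Y, h.negl, map_neg]; ring

theorem IsTwoForm.d3d2 {B : Cov2 IM M} (h : IsTwoForm B) : d3 (_root_.d2 B) = 0 := by
  funext X Y Z W
  have J : ∀ X Y Z W : VF IM M, B ⁅⁅X, Y⁆, Z⁆ W = B ⁅X, ⁅Y, Z⁆⁆ W - B ⁅Y, ⁅X, Z⁆⁆ W := by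
    intro X Y Z W
    rw [vf_lie_lie, h.subl]
  have S : ∀ X Y Z W : VF IM M, B ⁅X, ⁅Y, Z⁆⁆ W = - B ⁅⁅Y, Z⁆, X⁆ W := by
    intro X Y Z W
    rw [vf_skew, h.negl]
  simp only [d3, _root_.d2, map_add, map_sub, Derivation.commutator_apply, Pi.zero_apply]
  have s1 := h.skew ⁅X,Y⁆ ⁅Z,W⁆
  have s2 := h.skew ⁅X,Z⁆ ⁅Y,W⁆
  have s3 := h.skew ⁅X,W⁆ ⁅Y,Z⁆
  have j1 := J X Y Z W
  have j2 := J X Y W Z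
  have j3 := J X Z W Y
  have j4 := J Y Z W X
  simp only [S] at *
  linear_combination s1 - s2 + s3 + j1 - j2 + j3 - j4

end helpers

section poisson

theorem isOneForm_dF (f : SmoothR IM M) : IsOneForm (dF f : Cov1 IM M) :=
  ⟨fun _ _ => rfl, fun _ _ => rfl⟩

theorem isOneForm_lieDer (X : VF IM M) {α : Cov1 IM M} (h : IsOneForm α) :
    IsOneForm (lieDer X α) := by
  refine ⟨fun Y Z => ?_, fun f Y => ?_⟩
  · simp only [lieDer, vf_lie_add, h.1, map_add]; ring
  · simp only [lieDer, lie_smul_right', h.1, h.2, Derivation.leibniz, smul_eq_mul]; ring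

theorem IsBivector.apply {P : Cov1 IM M → VF IM M} (hP : IsBivector P) {α : Cov1 IM M}
    (h : IsOneForm α) (f : SmoothR IM M) : P α f = - α (P (dF f)) :=
  hP.2.2 (dF f) α (isOneForm_dF f) h

theorem IsPoisson.ham {P : Cov1 IM M → VF IM M} (hP : IsPoisson P) (f g : SmoothR IM M) :
    ⁅P (dF f), P (dF g)⁆ = P (dF (P (dF f) g)) := by
  have sk : ∀ f g : SmoothR IM M, P (dF f) g = - P (dF g) f := fun f g =>
    hP.1.apply (isOneForm_dF f) g
  ext1 k
  have J := hP.2 f g k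
  simp only [pbracket] at J
  rw [Derivation.commutator_apply, sk (P (dF f) g) k]
  rw [sk k f, map_neg] at J
  linear_combination J

theorem IsPoisson.ham1 {P : Cov1 IM M → VF IM M} (hP : IsPoisson P) (f : SmoothR IM M)
    {α : Cov1 IM M} (h : IsOneForm α) :
    ⁅P (dF f), P α⁆ = P (lieDer (P (dF f)) α) := by
  ext1 k
  rw [Derivation.commutator_apply, hP.1.apply (isOneForm_lieDer _ h), hP.1.apply h,
    hP.1.apply h, map_neg, lieDer, hP.ham]
  ring

/-- Cotangent bracket identity `α[Pβ,Pγ] = α(P[β,γ]_P)`, expanded, first for exact `α`. -/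
theorem IsPoisson.master0 {P : Cov1 IM M → VF IM M} (hP : IsPoisson P) (f : SmoothR IM M)
    {β γ : Cov1 IM M} (hβ : IsOneForm β) (hγ : IsOneForm γ) :
    ⁅P β, P γ⁆ f = - P β (γ (P (dF f))) + γ ⁅P β, P (dF f)⁆ + P γ (β (P (dF f)))
      - β ⁅P γ, P (dF f)⁆ + P (dF f) (γ (P β)) := by
  have e : γ ⁅P β, P (dF f)⁆ = γ (-⁅P (dF f), P β⁆) := by rw [vf_skew]
  have e' : β ⁅P γ, P (dF f)⁆ = - β ⁅P (dF f), P γ⁆ := by rw [vf_skew, hβ.neg]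
  rw [Derivation.commutator_apply, hP.1.apply hβ f, hP.1.apply hγ f, e, e', hγ.neg, hP.ham1 f hβ,
    hP.1.2.2 γ _ hγ (isOneForm_lieDer _ hβ), lieDer, map_neg, map_neg]
  have : P (dF f) (γ (P β)) = - P (dF f) (β (P γ)) := by rw [hP.1.2.2 γ β hγ hβ, map_neg]
  linear_combination -this

theorem IsPoisson.master {P : Cov1 IM M → VF IM M} (hP : IsPoisson P)
    {α β γ : Cov1 IM M} (hα : IsOneForm α) (hβ : IsOneForm β) (hγ : IsOneForm γ) :
    α ⁅P β, P γ⁆ = - P β (γ (P α)) + γ ⁅P β, P α⁆ + P γ (β (P α))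
      - β ⁅P γ, P α⁆ + P α (γ (P β)) := by
  have h1 := isOneForm_lieDer (P β) hγ
  have h2 := isOneForm_lieDer (P γ) hβ
  have h3 := isOneForm_dF (γ (P β))
  have hk : IsOneForm (lieDer (P β) γ - lieDer (P γ) β - dF (γ (P β))) := by
    refine ⟨fun Z Z' => ?_, fun g Z => ?_⟩
    · simp only [Pi.sub_apply, h1.1, h2.1, h3.1]; ring
    · simp only [Pi.sub_apply, h1.2, h2.2, h3.2]; ring
  have key : ⁅P β, P γ⁆ = P (lieDer (P β) γ - lieDer (P γ) β - dF (γ (P β))) := by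
    ext1 f
    rw [hP.1.apply hk, hP.master0 f hβ hγ]
    simp only [Pi.sub_apply, lieDer, dF]
    ring
  rw [key, hP.1.2.2 α _ hα hk]
  simp only [Pi.sub_apply, lieDer, dF]
  ring

end poisson

section gauge

/-- Expanded concomitant. -/
theorem concom_apply {P : Cov1 IM M → VF IM M} {A : VF IM M → VF IM M}
    (hi : ∀ α : Cov1 IM M, IsOneForm α → A (P α) = P (transp A α))
    {α β : Cov1 IM M} (hα : IsOneForm α) (Z : VF IM M) :
    concom P A α β Z = - α (A ⁅P β, Z⁆) + β (A ⁅P α, Z⁆) - β ⁅P α, A Z⁆ + α ⁅P β, A Z⁆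
      + Z (β (A (P α))) - A Z (β (P α)) := by
  simp only [concom, lieDer, transp, dF, bivFun, Pi.add_apply, Pi.sub_apply, hi α hα]
  ring

/-- Properties of `C = P♯ ∘ B♭`. -/
theorem BC_symm {P : Cov1 IM M → VF IM M} (hP : IsBivector P) {B : Cov2 IM M}
    (hB : IsTwoForm B) (X Y : VF IM M) : B (P (B X)) Y = B X (P (B Y)) := by
  rw [hB.skew, hP.2.2 _ _ (hB.1 Y) (hB.1 X), neg_neg]

theorem C_tensor {P : Cov1 IM M → VF IM M} (hP : IsBivector P) {B : Cov2 IM M}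
    (hB : IsTwoForm B) : IsTensor11 (fun X => P (B X)) := by
  refine ⟨fun X Y => ?_, fun f X => ?_⟩
  · have : B (X + Y) = B X + B Y := by funext Z; exact hB.addl X Y Z
    simp only [this, hP.1]
  · have : B (f • X) = f • B X := by funext Z; exact hB.smull f X Z
    simp only [this, hP.2.1]

theorem C_comm {P : Cov1 IM M → VF IM M} (hP : IsBivector P) {B : Cov2 IM M}
    (hB : IsTwoForm B) {α : Cov1 IM M} (hα : IsOneForm α) :
    P (B (P α)) = P (transp (fun X => P (B X)) α) := by
  congr 1
  funext X
  rw [transp, hB.skew, hP.2.2 α _ hα (hB.1 X)]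

theorem lcomp_two {P : Cov1 IM M → VF IM M} (hP : IsBivector P) {B : Cov2 IM M}
    (hB : IsTwoForm B) : IsTwoForm (lcomp B fun X => P (B X)) := by
  refine .mk' (fun X => hB.1 _) fun X Y => ?_
  simp only [lcomp]
  rw [BC_symm hP hB, hB.skew]

theorem iota_two {A : VF IM M → VF IM M} (hA : IsTensor11 A) {B : Cov2 IM M}
    (hB : IsTwoForm B) : IsTwoForm (iota2 A B) := by
  refine .mk' (fun X => ⟨fun Y Z => ?_, fun f Y => ?_⟩) fun X Y => ?_
  · simp only [iota2, hB.addr, hA.1]; ring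
  · simp only [iota2, hB.smulr, hA.2]; ring
  · simp only [iota2]
    rw [hB.skew, hB.skew X]; ring

theorem AA_two {A : VF IM M → VF IM M} (hA : IsTensor11 A) {B : Cov2 IM M}
    (hB : IsTwoForm B) : IsTwoForm (fun X Y => B (A X) (A Y)) := by
  refine .mk' (fun X => ⟨fun Y Z => ?_, fun f Y => ?_⟩) fun X Y => ?_
  · simp only [hB.addr, hA.1]
  · simp only [hB.smulr, hA.2]
  · exact hB.skew _ _

/-- Concomitant condition for the gauge-transformed tensor. -/
theorem concom_gauge {P : Cov1 IM M → VF IM M} (hP : IsPoisson P) {B : Cov2 IM M}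
    (hB : IsTwoForm B) {α β : Cov1 IM M} (hα : IsOneForm α) (hβ : IsOneForm β) (Z : VF IM M) :
    concom P (fun X => P (B X)) α β Z = - d2 B (P α) (P β) Z := by
  rw [concom_apply (fun α hα => C_comm hP.1 hB hα) hα]
  have hsw : ∀ {γ : Cov1 IM M} (_ : IsOneForm γ) V, γ (P (B V)) = - B V (P γ) :=
    fun hγ V => hP.1.2.2 _ _ hγ (hB.1 V)
  have m := hP.master hα hβ (hB.1 Z)
  have e1 : β ⁅P (B Z), P α⁆ = - β ⁅P α, P (B Z)⁆ := by rw [vf_skew, hβ.neg]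
  have e2 : B ⁅P α, P β⁆ Z = B Z ⁅P β, P α⁆ := by rw [hB.skew, vf_skew, hB.negr, neg_neg]
  simp only [hsw hα, hsw hβ, d2, e2]
  rw [m, e1, hB.skew (P α) Z, hB.skew (P β) Z]
  simp only [map_neg]
  ring

/-- Torsion condition for the gauge-transformed tensor. -/
theorem torsion_gauge {P : Cov1 IM M → VF IM M} (hP : IsPoisson P) {A : VF IM M → VF IM M}
    (hA : IsTensor11 A) {φ H : Cov3 IM M} (hφ : IsThreeForm φ) (hH : IsThreeForm H)
    (hi : ∀ α : Cov1 IM M, IsOneForm α → A (P α) = P (transp A α))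
    (hii : ∀ α β : Cov1 IM M, IsOneForm α → IsOneForm β → ∀ Z,
      - α (A ⁅P β, Z⁆) + β (A ⁅P α, Z⁆) - β ⁅P α, A Z⁆ + α ⁅P β, A Z⁆
      + Z (β (A (P α))) - A Z (β (P α)) = - H (P α) (P β) Z)
    (hiii : ∀ X Y, torsion A X Y = P (fun Z => φ X Y Z + H (A X) Y Z + H X (A Y) Z))
    {B : Cov2 IM M} (hB : IsTwoForm B) (X Y : VF IM M) :
    torsion (fun X => A X + P (B X)) X Y =
      P (fun Z => (φ - d2 (lcomp B fun X => P (B X)) - d2 (iota2 A B)) X Y Z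
        + (H + d2 B) (A X + P (B X)) Y Z + (H + d2 B) X (A Y + P (B Y)) Z) := by
  have hC := C_tensor hP.1 hB
  have hAs : ∀ X Y, A (X - Y) = A X - A Y := by
    intro X Y
    have := hA.1 (X - Y) Y
    rw [sub_add_cancel] at this
    rw [this, add_sub_cancel_right]
  have hCs : ∀ X Y, P (B (X - Y)) = P (B X) - P (B Y) := by
    intro X Y
    have : P (B (X - Y + Y)) = P (B (X - Y)) + P (B Y) := hC.1 (X - Y) Y
    rw [sub_add_cancel] at this
    rw [this, add_sub_cancel_right]
  have hCa : ∀ X Y, P (B (X + Y)) = P (B X) + P (B Y) := hC.1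
  have hBd := hB.d2
  have f1 := (hφ.sub (lcomp_two hP.1 hB).d2).sub (iota_two hA hB).d2
  have f2 := hH.add hB.d2
  ext1 f
  rw [hP.1.apply]
  swap
  · refine ⟨fun Z Z' => ?_, fun g Z => ?_⟩
    · beta_reduce; rw [f1.add3, f2.add3, f2.add3]; ring
    · beta_reduce; rw [(f1.1 _ _).2, (f2.1 _ _).2, (f2.1 _ _).2]; ring
  have t := congrArg (fun V : VF IM M => V f) (hiii X Y)
  rw [hP.1.apply ?_] at t
  swap
  · refine ⟨fun Z Z' => ?_, fun g Z => ?_⟩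
    · beta_reduce; rw [hφ.add3, hH.add3, hH.add3]; ring
    · beta_reduce; rw [(hφ.1 _ _).2, (hH.1 _ _).2, (hH.1 _ _).2]; ring
  have c1 := hii (dF f) (B Y) (isOneForm_dF f) (hB.1 Y) X
  have c2 := hii (dF f) (B X) (isOneForm_dF f) (hB.1 X) Y
  have m := hP.master0 f (hB.1 X) (hB.1 Y)
  have hCf : ∀ X, P (B X) f = - B X (P (dF f)) := fun X => hP.1.apply (hB.1 X) f
  have hACf : ∀ X, A (P (B X)) f = - B X (A (P (dF f))) := by
    intro X
    rw [hi _ (hB.1 X)]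
    refine (hP.1.apply ⟨fun Z Z' => ?_, fun g Z => ?_⟩ f).trans rfl
    · simp only [transp, hA.1, hB.addr]
    · simp only [transp, hA.2, hB.smulr]
  generalize P (dF f) = Z at *
  have hZ : ∀ V : VF IM M, dF f V = V f := fun V => rfl
  simp only [hZ] at c1 c2
  simp only [torsion, hAs, hA.1, hCs, hCa, vf_add_lie, vf_lie_add, Derivation.sub_apply,
    Derivation.add_apply, hCf, hACf, Pi.add_apply, Pi.sub_apply, hBd.add1, hBd.add2, hH.add1,
    hH.add2] at t ⊢
  have L1 : ∀ U V W : VF IM M, B W ⁅U, V⁆ = - B ⁅U, V⁆ W := fun U V W => hB.skew _ _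
  have L2 : ∀ U V W : VF IM M, B W (A ⁅U, V⁆) = - B (A ⁅U, V⁆) W := fun U V W => hB.skew _ _
  have bc := BC_symm hP.1 hB
  have L3 : B Y (P (B X)) = - B X (P (B Y)) := by rw [hB.skew, bc]
  have hAn : ∀ X, A (-X) = - A X := by
    intro X
    have h0 : A 0 = 0 := by simpa using hA.2 0 0
    rw [← zero_sub, hAs, h0, zero_sub]
  rw [vf_skew (P (B Y)) X, vf_skew (P (B Y)) (A X), vf_skew Z X, vf_skew Z (A X)] at c1
  rw [vf_skew Z Y, vf_skew Z (A Y)] at c2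
  simp only [d2, lcomp, iota2, hAn, L1, L2, hB.negr, hB.negl, map_neg, map_add, bc, L3,
    Derivation.neg_apply, hB.skew Y X, hB.skew Z X, hB.skew Z Y] at c1 c2 m ⊢
  linear_combination t - c1 + c2 + m - hH.skew12 Z (P (B X)) Y + hH.skew23 (P (B X)) Z Y
    + hH.skew12 Z (P (B Y)) X - hH.skew23 (P (B Y)) Z X + hH.skew12 X (P (B Y)) Z

end gauge

section closed

/-- The 3-form `ι_{N_A} B`. -/
def torS (A : VF IM M → VF IM M) (B : Cov2 IM M) : Cov3 IM M := fun X Y Z =>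
  B (torsion A X Y) Z + B (torsion A Y Z) X + B (torsion A Z X) Y

theorem IsTensor11.sub {A : VF IM M → VF IM M} (hA : IsTensor11 A) (X Y : VF IM M) :
    A (X - Y) = A X - A Y := by
  have := hA.1 (X - Y) Y
  rw [sub_add_cancel] at this
  rw [this, add_sub_cancel_right]

theorem IsTensor11.neg {A : VF IM M → VF IM M} (hA : IsTensor11 A) (X : VF IM M) :
    A (-X) = - A X := by
  have h0 : A 0 = 0 := by simpa using hA.2 0 0
  rw [← zero_sub, hA.sub, h0, zero_sub]

theorem torS_eq {A : VF IM M → VF IM M} (hA : IsTensor11 A) {B : Cov2 IM M} (hB : IsTwoForm B) :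
    torS A B - iota3 A (d2 (iota2 A B)) + cyc (d2 B) A A
      = - d2 ((fun X Y => B (A X) (A Y)) + iota2 (fun X => A (A X)) B) := by
  funext X Y Z
  have L1 : ∀ U V W : VF IM M, B W ⁅U, V⁆ = - B ⁅U, V⁆ W := fun U V W => hB.skew _ _
  have L2 : ∀ U V W : VF IM M, B W (A ⁅U, V⁆) = - B (A ⁅U, V⁆) W := fun U V W => hB.skew _ _
  simp only [torS, torsion, iota3, cyc, d2, iota2, Pi.add_apply, Pi.sub_apply, Pi.neg_apply,
    hA.sub, hA.1, hB.subl, hB.addl, map_add,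
    vf_skew Z X, vf_skew (A Z) X, vf_skew Z (A X), vf_skew (A Z) (A X), vf_skew Y X, 
    vf_skew (A Y) X, vf_skew Y (A X), vf_skew Z Y, vf_skew (A Z) Y, vf_skew Z (A Y),
    hA.neg, hB.negl, hB.negr, L1, L2, map_neg,
    hB.skew Z X, hB.skew (A Z) X, hB.skew Z (A X), hB.skew (A Z) (A X),
    hB.skew Z Y, hB.skew (A Z) Y, hB.skew Z (A Y),
    hB.skew Y X, hB.skew (A Y) X, hB.skew Y (A X)]
  ring

theorem torS_closed {A : VF IM M → VF IM M} (hA : IsTensor11 A) {B : Cov2 IM M}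
    (hB : IsTwoForm B) :
    d3 (torS A B - iota3 A (d2 (iota2 A B)) + cyc (d2 B) A A) = 0 := by
  have hAA : IsTensor11 (fun X => A (A X)) :=
    ⟨fun X Y => by simp only [hA.1], fun f X => by simp only [hA.2]⟩
  rw [torS_eq hA hB, ← d2_neg]
  exact ((AA_two hA hB).add (iota_two hAA hB)).neg.d3d2

theorem IsThreeForm.cyc3 {φ : Cov3 IM M} (h : IsThreeForm φ) (X Y Z) : φ X Y Z = φ Z X Y := by
  rw [h.skew23, h.skew12, neg_neg]

theorem cyc_apply {H : Cov3 IM M} (h : IsThreeForm H) (S T : VF IM M → VF IM M) (X Y Z) :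
    cyc H S T X Y Z = H (S X) (T Y) Z + H X (S Y) (T Z) + H (T X) Y (S Z) := by
  rw [cyc, h.cyc3 (S Y), ← h.cyc3 (T X)]

theorem torS_apply {P : Cov1 IM M → VF IM M} (hP : IsBivector P) {A : VF IM M → VF IM M}
    {φ H : Cov3 IM M} (hφ : IsThreeForm φ) (hH : IsThreeForm H)
    (hiii : ∀ X Y, torsion A X Y = P (fun Z => φ X Y Z + H (A X) Y Z + H X (A Y) Z))
    {B : Cov2 IM M} (hB : IsTwoForm B) (X Y Z : VF IM M) :
    torS A B X Y Z = iota3 (fun X => P (B X)) φ X Y Z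
      + (H (A X) Y (P (B Z)) + H X (A Y) (P (B Z)) + H (P (B X)) (A Y) Z + H (P (B X)) Y (A Z)
        + H X (P (B Y)) (A Z) + H (A X) (P (B Y)) Z) := by
  have key : ∀ X Y Z, B (torsion A X Y) Z
      = φ X Y (P (B Z)) + H (A X) Y (P (B Z)) + H X (A Y) (P (B Z)) := by
    intro X Y Z
    rw [hiii, hB.skew, hP.2.2 _ _ (hB.1 Z), neg_neg]
    refine ⟨fun Z Z' => ?_, fun g Z => ?_⟩
    · beta_reduce; rw [hφ.add3, hH.add3, hH.add3]; ring
    · beta_reduce; rw [(hφ.1 _ _).2, (hH.1 _ _).2, (hH.1 _ _).2]; ring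
  simp only [torS, key, iota3]
  rw [hφ.cyc3 Y Z, hH.cyc3 (A Y) Z, hH.cyc3 Y (A Z), ← hφ.cyc3 X _ Z, ← hH.cyc3 X _ (A Z),
    ← hH.cyc3 (A X) _ Z]
  ring

theorem isThreeForm_zero : IsThreeForm (0 : Cov3 IM M) := by
  refine .mk' (fun X Y => ⟨fun Z Z' => ?_, fun f Z => ?_⟩) (fun X Y Z => ?_) fun X Y Z => ?_ <;>
  simp

theorem torsion_C {P : Cov1 IM M → VF IM M} (hP : IsPoisson P) {B : Cov2 IM M}
    (hB : IsTwoForm B) (X Y : VF IM M) :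
    torsion (fun X => P (B X)) X Y =
      P (fun Z => (- d2 (lcomp B fun X => P (B X))) X Y Z
        + d2 B (P (B X)) Y Z + d2 B X (P (B Y)) Z) := by
  have h0 : ∀ {α : Cov1 IM M}, IsOneForm α → α 0 = 0 := fun h => by simpa using h.2 0 0
  have hl0 : ∀ X : VF IM M, ⁅X, (0 : VF IM M)⁆ = 0 := fun X => by
    ext1 g
    simp [Derivation.commutator_apply]
  have hP0 : P 0 = 0 := by simpa using hP.1.2.1 0 0
  have e := torsion_gauge (A := fun _ => 0) (φ := 0) (H := 0) hP
    ⟨fun _ _ => by simp, fun _ _ => by simp⟩ isThreeForm_zero isThreeForm_zero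
    (fun α hα => by
      have : transp (fun _ => 0) α = 0 := by funext X; exact h0 hα
      rw [this, hP0])
    (fun α β hα hβ Z => by simp [h0 hα, h0 hβ, hl0])
    (fun X Y => by
      have : (fun Z => (0 : Cov3 IM M) X Y Z + (0 : Cov3 IM M) 0 Y Z + (0 : Cov3 IM M) X 0 Z)
        = 0 := by funext Z; simp
      rw [this, hP0]; simp [torsion]) hB X Y
  have hι : iota2 (fun _ => (0 : VF IM M)) B = 0 := by
    funext X Y
    simp only [iota2, h0 (hB.1 X), Pi.zero_apply, add_zero]
    exact h0 (hB.2.1 Y)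
  have hd : d2 (0 : Cov2 IM M) = 0 := by funext X Y Z; simp [d2]
  simpa only [zero_add, zero_sub, hι, hd, sub_zero] using e

theorem six_cancel {f : SmoothR IM M} (h : 6 * f = 0) : f = 0 := by
  have h2 : (6 : ℝ) • f = 0 := by
    have e : (6 : ℝ) • f = f + f + f + f + f + f := by module
    rw [e]; linear_combination h
  have := congrArg (fun g => (6⁻¹ : ℝ) • g) h2
  simpa [smul_smul] using this

theorem cyc_closed {P : Cov1 IM M → VF IM M} (hP : IsPoisson P) {A : VF IM M → VF IM M}
    (hA : IsTensor11 A) {φ H : Cov3 IM M} (hφ : IsThreeForm φ) (hH : IsThreeForm H)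
    {B : Cov2 IM M} (hB : IsTwoForm B)
    (hiii : ∀ X Y, torsion A X Y = P (fun Z => φ X Y Z + H (A X) Y Z + H X (A Y) Z))
    (hiii' : ∀ X Y, torsion (fun X => A X + P (B X)) X Y =
      P (fun Z => (φ - d2 (lcomp B fun X => P (B X)) - d2 (iota2 A B)) X Y Z
        + (H + d2 B) (A X + P (B X)) Y Z + (H + d2 B) X (A Y + P (B Y)) Z))
    (hiv : d3 (iota3 A φ + cyc H A A) = 0) :
    d3 (iota3 (fun X => A X + P (B X)) (φ - d2 (lcomp B fun X => P (B X)) - d2 (iota2 A B))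
      + cyc (H + d2 B) (fun X => A X + P (B X)) (fun X => A X + P (B X))) = 0 := by
  have hC := C_tensor hP.1 hB
  have hL := lcomp_two hP.1 hB
  have hc := hL.d2
  have ha := (iota_two hA hB).d2
  have hBd := hB.d2
  have hT : IsTensor11 (fun X => A X + P (B X)) := by
    refine ⟨fun X Y => ?_, fun f X => ?_⟩
    · have := hC.1 X Y
      simp only at this
      simp only [this, hA.1]; abel
    · have := hC.2 f X
      simp only at this
      simp only [this, hA.2, smul_add]
  have f1 := (hφ.sub hc).sub ha
  have f2 := hH.add hBd
  have f3 : IsThreeForm (- d2 (lcomp B fun X => P (B X))) := by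
    rw [← zero_sub]; exact isThreeForm_zero.sub hc
  have rA := torS_closed hA hB
  have rT := torS_closed hT hB
  have rC := torS_closed hC hB
  have e1 : iota2 (fun X => P (B X)) B = (lcomp B fun X => P (B X)) + lcomp B fun X => P (B X) := by
    funext X Y
    simp only [iota2, lcomp, Pi.add_apply, BC_symm hP.1 hB]
  have e2 : iota2 (fun X => A X + P (B X)) B = iota2 A B + iota2 (fun X => P (B X)) B := by
    funext X Y
    simp only [iota2, Pi.add_apply, hB.addl, hB.addr]; ring
  rw [e2, e1, d2_add, d2_add] at rT
  rw [e1, d2_add] at rC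
  have sA : torS A B = _ := funext fun X => funext fun Y => funext fun Z =>
    torS_apply hP.1 hφ hH hiii hB X Y Z
  have sT : torS (fun X => A X + P (B X)) B = _ := funext fun X => funext fun Y => funext fun Z =>
    torS_apply hP.1 f1 f2 hiii' hB X Y Z
  have sC : torS (fun X => P (B X)) B = _ := funext fun X => funext fun Y => funext fun Z =>
    torS_apply hP.1 f3 hBd (torsion_C hP hB) hB X Y Z
  rw [sA] at rA
  rw [sT] at rT
  rw [sC] at rC
  generalize d2 (lcomp B fun X => P (B X)) = c at *
  generalize d2 (iota2 A B) = a at *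
  generalize d2 B = b at *
  obtain ⟨C, hCdef⟩ : ∃ C : VF IM M → VF IM M, C = fun X => P (B X) := ⟨_, rfl⟩
  have hCe : ∀ X, P (B X) = C X := fun X => by rw [hCdef]
  simp only [hCe] at *
  clear hCdef sA sT sC hiii hiii' hL hT hC e1 e2
  have lin : ∀ {D rA rT rC E : Cov3 IM M}, d3 rA = 0 → d3 rT = 0 → d3 rC = 0 → d3 E = 0 →
      (∀ X Y Z, 6 * D X Y Z = 6 * E X Y Z + 3 * rA X Y Z + 3 * rT X Y Z - rC X Y Z) →
      d3 D = 0 := by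
    intro D rA rT rC E h1 h2 h3 h4 h
    have hf : D + D + D + D + D + D = E + E + E + E + E + E + rA + rA + rA + rT + rT + rT - rC := by
      funext X Y Z
      simp only [Pi.add_apply, Pi.sub_apply]
      linear_combination h X Y Z
    have := congrArg d3 hf
    simp only [d3_add, d3_sub, h1, h2, h3, h4] at this
    funext X Y Z W
    have := congrFun (congrFun (congrFun (congrFun this X) Y) Z) W
    simp only [Pi.add_apply, Pi.sub_apply, Pi.zero_apply] at this
    refine six_cancel ?_
    linear_combination this
  refine lin rA rT rC hiv fun X Y Z => ?_
  simp only [Pi.add_apply, Pi.sub_apply, Pi.neg_apply, cyc_apply hH, cyc_apply hBd, cyc_apply f2,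
    iota3, hφ.add1, hφ.add2, hφ.add3, hH.add1, hH.add2, hH.add3, hc.add1, hc.add2, hc.add3,
    ha.add1, ha.add2, ha.add3, hBd.add1, hBd.add2, hBd.add3]
  ring

end closed

/-- **Theorem 3.1 (gauge transformations of PqNb structures).**
Let `(P,A,φ,H)` be a Poisson quasi-Nijenhuis structure with background on `M` and `B` a
2-form on `M`.  With `C = P♯ ∘ B♭`, the quadruple
`(P, A + C, φ - dB_C - d(ι_A B), H + dB)` is again a Poisson quasi-Nijenhuis structure
with background on `M`. -/
theorem gauge_transformation_of_PqNb
    (P : Cov1 IM M → VF IM M) (A : VF IM M → VF IM M) (φ H : Cov3 IM M)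
    (hPqNb : IsPqNb P A φ H) (B : Cov2 IM M) (hB : IsTwoForm B) :
    IsPqNb P (fun X => A X + P (B X))
      (φ - d2 (lcomp B fun X => P (B X)) - d2 (iota2 A B))
      (H + d2 B) := by
  obtain ⟨hP, hA, hφ, hφd, hH, hHd, hi, hii, hiii, hiv⟩ := hPqNb
  have hC := C_tensor hP.1 hB
  have hii' : ∀ α β : Cov1 IM M, IsOneForm α → IsOneForm β → ∀ Z,
      - α (A ⁅P β, Z⁆) + β (A ⁅P α, Z⁆) - β ⁅P α, A Z⁆ + α ⁅P β, A Z⁆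
      + Z (β (A (P α))) - A Z (β (P α)) = - H (P α) (P β) Z := by
    intro α β hα hβ Z
    rw [← concom_apply hi hα, hii α β hα hβ]
  have hL := lcomp_two hP.1 hB
  have hI := iota_two hA hB
  have hT := torsion_gauge hP hA hφ hH hi hii' hiii hB
  have hφ' : d3 (φ - d2 (lcomp B fun X => P (B X)) - d2 (iota2 A B)) = 0 := by
    rw [d3_sub, d3_sub, hφd, hL.d3d2, hI.d3d2, sub_zero, sub_zero]
  have i40 : ∀ A : VF IM M → VF IM M, iota4 A 0 = 0 := fun A => by
    funext X Y Z W; simp [iota4]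
  have hi' : ∀ α : Cov1 IM M, IsOneForm α →
      A (P α) + P (B (P α)) = P (transp (fun X => A X + P (B X)) α) := by
    intro α hα
    rw [hi α hα, C_comm hP.1 hB hα, ← hP.1.1]
    congr 1
    funext X
    simp only [transp, Pi.add_apply, hα.1]
  refine ⟨hP, ⟨fun X Y => ?_, fun f X => ?_⟩, (hφ.sub hL.d2).sub hI.d2, hφ', hH.add hB.d2, ?_, hi',
    fun α β hα hβ => ?_, hT, ?_⟩
  · have := hC.1 X Y
    simp only at this
    simp only [this, hA.1]; abel
  · have := hC.2 f X
    simp only at this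
    simp only [this, hA.2, smul_add]
  · rw [d3_add, hHd, hB.d3d2, add_zero]
  · funext Z
    have h1 := hii' α β hα hβ Z
    have h2 := concom_gauge hP hB hα hβ Z
    rw [concom_apply (fun α hα => C_comm hP.1 hB hα) hα] at h2
    rw [concom_apply hi' hα]
    simp only [hα.1, hβ.1, vf_lie_add, map_add, Derivation.add_apply, Pi.add_apply]
    linear_combination h1 + h2
  · have hiv' : d3 (iota3 A φ + cyc H A A) = 0 := by
      rw [dA3, hφd, i40] at hiv
      rw [d3_add, ← hiv]; abel
    have := cyc_closed hP hA hφ hH hB hiii hT hiv'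
    rw [d3_add] at this
    rw [dA3, hφ', i40, zero_sub]
    exact neg_eq_of_add_eq_zero_right this

end
end

section
/- Let Q be a bivector field, φ and H 3-forms, and A a (1,1)-tensor on a smooth manifold M such that N_A(X,Y) = Q♯(ι_{X∧Y}φ + ι_{AX∧Y}H + ι_{X∧AY}H) for all vector fields X,Y. Let B be a 2-form and C = Q♯∘B♭. Then d_A(ι_A B) = ℋ^{A,C} + ℋ^{C,A} + ℬ^{A,A} − dB_{A,A} + ι_C φ, where ℋ^{S,T}(X,Y,Z) = Σ_{cyclic(X,Y,Z)} H(SX,TY,Z), ℬ^{S,T}(X,Y,Z) = Σ_{cyclic(X,Y,Z)} dB(SX,TY,Z), and B_{A,A}(X,Y) = B(AX,AY). -/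
open scoped Manifold

noncomputable section

/-! ### Smooth functions, vector fields and tensor calculus on a manifold

We work with the algebraic (Lie–Rinehart) presentation of the Cartan calculus of a
smooth manifold `M`:  smooth real functions form a commutative ring, vector fields are
the derivations of that ring, differential forms are alternating multilinear maps on
vector fields with values in functions, and all classical operations (`d`, interior
products, Lie derivatives, Nijenhuis torsion, concomitants, ...) are given by their
global Koszul-type formulas. -/

variable {EM : Type*} [NormedAddCommGroup EM] [NormedSpace ℝ EM]
  {HM : Type*} [TopologicalSpace HM] (IM : ModelWithCorners ℝ EM HM)
  (M : Type*) [TopologicalSpace M] [ChartedSpace HM M]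

variable {IM M}

/-- **Lemma 3.4.**  Let `Q` be a bivector field, `φ, H` 3-forms and `A` a `(1,1)`-tensor
with `N_A(X,Y) = Q♯(ι_{X∧Y}φ + ι_{AX∧Y}H + ι_{X∧AY}H)`.  For a 2-form `B` and
`C = Q♯ ∘ B♭` one has
`d_A(ι_A B) = ℋ^{A,C} + ℋ^{C,A} + ℬ^{A,A} - dB_{A,A} + ι_C φ`. -/
theorem dA_iotaA_identity
    (Q : Cov1 IM M → VF IM M) (hQ : IsBivector Q)
    (φ H : Cov3 IM M) (hφ : IsThreeForm φ) (hH : IsThreeForm H)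
    (A : VF IM M → VF IM M) (hA : IsTensor11 A)
    (htor : ∀ X Y, torsion A X Y =
      Q (fun Z => φ X Y Z + H (A X) Y Z + H X (A Y) Z))
    (B : Cov2 IM M) (hB : IsTwoForm B) :
    dA2 A (iota2 A B) =
      cyc H A (fun X => Q (B X)) + cyc H (fun X => Q (B X)) A
        + cyc (d2 B) A A - d2 (fun X Y => B (A X) (A Y))
        + iota3 (fun X => Q (B X)) φ := by
  obtain ⟨hB1, hB2, hB3⟩ := hB
  obtain ⟨hA1, hA2⟩ := hA
  obtain ⟨hQ1, hQ2, hQ3⟩ := hQ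
  obtain ⟨hφ1, hφ2, hφ3, hφ4, hφ5, hφ6⟩ := hφ
  obtain ⟨hH1, hH2, hH3, hH4, hH5, hH6⟩ := hH
  have badd : ∀ U V W, B (U + V) W = B U W + B V W := fun U V W => (hB2 W).1 U V
  have badd' : ∀ U V W, B U (V + W) = B U V + B U W := fun U V W => (hB1 U).1 V W
  have bneg : ∀ U W, B (-U) W = - B U W := by
    intro U W
    have h0 := badd 0 0 W
    have h := badd (-U) U W
    rw [add_zero] at h0
    rw [neg_add_cancel] at h
    linear_combination -h0 - h
  have bsub : ∀ U V W, B (U - V) W = B U W - B V W := by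
    intro U V W
    rw [sub_eq_add_neg, badd, bneg, sub_eq_add_neg]
  have aneg : ∀ U, A (-U) = - A U := by
    intro U
    have h0 : A 0 = 0 := by
      have := hA1 0 0
      rwa [add_zero, left_eq_add] at this
    have h := hA1 (-U) U
    rw [neg_add_cancel, h0] at h
    exact eq_neg_of_add_eq_zero_left h.symm
  have asub : ∀ U V, A (U - V) = A U - A V := by
    intro U V
    rw [sub_eq_add_neg, hA1, aneg, sub_eq_add_neg]
  have bskew : ∀ U V, B U V = - B V U := by
    intro U V
    have h := hB3 (U + V)
    rw [badd, badd', badd', hB3, hB3] at h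
    linear_combination h
  have hskew12 : ∀ U V W, H U V W = - H V U W := by
    intro U V W
    have h := hH4 (U + V) W
    have e1 := (hH3 (U + V) W).1 U V
    have e2 := (hH2 U W).1 U V
    have e3 := (hH2 V W).1 U V
    simp only at e1 e2 e3
    rw [e1, e2, e3, hH4, hH4] at h
    linear_combination h
  have hskew23 : ∀ U V W, H U V W = - H U W V := by
    intro U V W
    have h := hH5 U (V + W)
    have e1 := (hH2 U (V + W)).1 V W
    have e2 := (hH1 U V).1 V W
    have e3 := (hH1 U W).1 V W
    simp only at e1
    rw [e1, e2, e3, hH5, hH5] at h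
    linear_combination h
  have pskew12 : ∀ U V W, φ U V W = - φ V U W := by
    intro U V W
    have h := hφ4 (U + V) W
    have e1 := (hφ3 (U + V) W).1 U V
    have e2 := (hφ2 U W).1 U V
    have e3 := (hφ2 V W).1 U V
    simp only at e1 e2 e3
    rw [e1, e2, e3, hφ4, hφ4] at h
    linear_combination h
  have pskew23 : ∀ U V W, φ U V W = - φ U W V := by
    intro U V W
    have h := hφ5 U (V + W)
    have e1 := (hφ2 U (V + W)).1 V W
    have e2 := (hφ1 U V).1 V W
    have e3 := (hφ1 U W).1 V W
    simp only at e1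
    rw [e1, e2, e3, hφ5, hφ5] at h
    linear_combination h
  have dskew12 : ∀ U V W, d2 B U V W = - d2 B V U W := by
    intro U V W
    simp only [d2]
    rw [← lie_skew U V, bskew U V, bneg, map_neg]
    ring
  have dskew23 : ∀ U V W, d2 B U V W = - d2 B U W V := by
    intro U V W
    simp only [d2]
    rw [← lie_skew V W, bskew V W, bneg, map_neg]
    ring
  have key : ∀ U V W, B (torsion A U V) W
      = φ U V (Q (B W)) + H (A U) V (Q (B W)) + H U (A V) (Q (B W)) := by
    intro U V W
    have hα : IsOneForm (fun Z => φ U V Z + H (A U) V Z + H U (A V) Z) := by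
      refine ⟨fun S T => ?_, fun f S => ?_⟩
      · simp only [(hφ1 U V).1 S T, (hH1 (A U) V).1 S T, (hH1 U (A V)).1 S T]
        ring
      · simp only [(hφ1 U V).2 f S, (hH1 (A U) V).2 f S, (hH1 U (A V)).2 f S]
        ring
    rw [htor, bskew, ← hQ3 _ _ hα (hB1 W)]
  funext X Y Z
  have k1 := key X Y Z
  have k2 := key Y Z X
  have k3 := key X Z Y
  have c1 : cyc H A (fun X => Q (B X)) X Y Z + cyc H (fun X => Q (B X)) A X Y Z
      + iota3 (fun X => Q (B X)) φ X Y Z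
      = B (torsion A X Y) Z + B (torsion A Y Z) X - B (torsion A X Z) Y := by
    rw [k1, k2, k3]
    simp only [cyc, iota3]
    linear_combination pskew12 (Q (B X)) Y Z - pskew23 Y (Q (B X)) Z + pskew23 X (Q (B Y)) Z + hskew23 (A X) (Q (B Y)) Z + hskew23 (A Y) (Q (B Z)) X - hskew12 (A Y) X (Q (B Z)) + hskew23 (A Z) (Q (B X)) Y - hskew12 (A Z) Y (Q (B X)) + hskew12 (Q (B X)) (A Y) Z - hskew23 (A Y) (Q (B X)) Z + hskew12 (Q (B Y)) (A Z) X - hskew23 (A Z) (Q (B Y)) X + hskew12 (A Z) X (Q (B Y)) + hskew12 (Q (B Z)) (A X) Y - hskew23 (A X) (Q (B Z)) Y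
  have c2 : cyc (d2 B) A A X Y Z
      = d2 B (A X) (A Y) Z + d2 B X (A Y) (A Z) + d2 B (A X) Y (A Z) := by
    simp only [cyc]
    linear_combination dskew23 (A Y) (A Z) X - dskew12 (A Y) X (A Z) + dskew12 (A Z) (A X) Y - dskew23 (A X) (A Z) Y
  simp only [Pi.add_apply, Pi.sub_apply]
  suffices h : dA2 A (iota2 A B) X Y Z = (B (torsion A X Y) Z + B (torsion A Y Z) X
      - B (torsion A X Z) Y) + (d2 B (A X) (A Y) Z + d2 B X (A Y) (A Z) + d2 B (A X) Y (A Z))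
      - d2 (fun X Y => B (A X) (A Y)) X Y Z by
    rw [h, ← c1, ← c2]
    ring
  simp only [dA2, iota3, iota2, d2, torsion, Pi.sub_apply, badd, bsub, hA1, asub, map_add]
  ring

end
end
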